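/- Let Z* be the membership matrix of a partition of {1,…,n} with cluster sizes n₁,…,n_K. For any Z in 𝒞 = {Z : Z = Zᵀ, Z ⪰ 0, Z·1 = 1, Z ≥ 0}, one has ‖Z* − Z‖₁ ≤ 4n·Σ_{k=1}^K Σ_{m≠k} (1/n_k)·‖Z_{G_k* G_m*}‖₁ + n·(tr(Z) − tr(Z*)). -/

import Mathlib

open Matrix BigOperators

/-- The feasible set 𝒞 = {Z : Z = Zᵀ, Z ⪰ 0, Z·1 = 1, Z ≥ 0 entrywise} (no trace constraint). -/
def sdpFeasible {n : ℕ} (Z : Matrix (Fin n) (Fin n) ℝ) : Prop :=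
  Z.IsSymm ∧ Z.PosSemidef ∧ (∀ i, ∑ j, Z i j = 1) ∧ (∀ i j, 0 ≤ Z i j)

/-- The membership matrix Z* of the partition given by the label map σ. -/
noncomputable def memberMatrix {n K : ℕ} (σ : Fin n → Fin K) : Matrix (Fin n) (Fin n) ℝ :=
  Matrix.of fun i j =>
    if σ i = σ j then (1 : ℝ) / ((Finset.univ.filter fun l => σ l = σ i).card : ℝ) else 0

/-- Entrywise ℓ¹ norm of a matrix. -/
def l1Norm {n : ℕ} (M : Matrix (Fin n) (Fin n) ℝ) : ℝ := ∑ i, ∑ j, |M i j|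

/-- Size n_k of the k-th cluster. -/
def clusterSize {n K : ℕ} (σ : Fin n → Fin K) (k : Fin K) : ℕ :=
  (Finset.univ.filter fun i => σ i = k).card

/-- ℓ¹ norm of the (G_k*, G_m*) submatrix of Z. -/
def blockL1 {n K : ℕ} (σ : Fin n → Fin K) (Z : Matrix (Fin n) (Fin n) ℝ)
    (k m : Fin K) : ℝ :=
  ∑ i ∈ Finset.univ.filter (fun i => σ i = k), ∑ j ∈ Finset.univ.filter (fun j => σ j = m), |Z i j|

lemma psd_l1_le {n : ℕ} (A : Matrix (Fin n) (Fin n) ℝ) (hA : A.PosSemidef) :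
    l1Norm A ≤ n * A.trace := by
  have hs : ∀ i j, A i j = A j i := fun i j => by
    have := hA.isHermitian.apply i j
    simpa using this.symm
  have key : ∀ i j, |A i j| ≤ (A i i + A j j) / 2 := by
    intro i j
    have h1 := hA.dotProduct_mulVec_nonneg (Pi.single i 1 + Pi.single j 1)
    have h2 := hA.dotProduct_mulVec_nonneg (Pi.single i 1 - Pi.single j 1)
    simp [Matrix.mulVec_add, Matrix.mulVec_sub, add_dotProduct, sub_dotProduct] at h1 h2
    rw [abs_le]
    have := hs i j
    constructor <;> linarith
  unfold l1Norm
  calc _ ≤ ∑ i, ∑ j, (A i i + A j j) / 2 :=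
        Finset.sum_le_sum fun i _ => Finset.sum_le_sum fun j _ => key i j
    _ = n * A.trace := by
        simp only [← Finset.sum_div, Finset.sum_add_distrib, Finset.sum_const, Finset.card_univ,
          Fintype.card_fin, nsmul_eq_mul, Matrix.trace, Matrix.diag, ← Finset.mul_sum]
        ring

lemma l1_add {n : ℕ} (A B : Matrix (Fin n) (Fin n) ℝ) :
    l1Norm (A + B) ≤ l1Norm A + l1Norm B := by
  unfold l1Norm
  simp only [← Finset.sum_add_distrib]
  exact Finset.sum_le_sum fun i _ => Finset.sum_le_sum fun j _ => abs_add_le _ _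

lemma l1_neg {n : ℕ} (A : Matrix (Fin n) (Fin n) ℝ) : l1Norm (-A) = l1Norm A := by
  simp [l1Norm]

lemma l1_transpose {n : ℕ} (A : Matrix (Fin n) (Fin n) ℝ) : l1Norm Aᵀ = l1Norm A := by
  unfold l1Norm
  rw [Finset.sum_comm]
  rfl

lemma l1_mul_le {n : ℕ} (P M : Matrix (Fin n) (Fin n) ℝ) (h0 : ∀ i j, 0 ≤ P i j)
    (h1 : ∀ j, ∑ i, P i j = 1) : l1Norm (P * M) ≤ l1Norm M := by
  unfold l1Norm
  calc _ ≤ ∑ i, ∑ j, ∑ l, P i l * |M l j| := by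
        refine Finset.sum_le_sum fun i _ => Finset.sum_le_sum fun j _ => ?_
        rw [Matrix.mul_apply]
        refine (Finset.abs_sum_le_sum_abs _ _).trans (Finset.sum_le_sum fun l _ => ?_)
        rw [abs_mul, abs_of_nonneg (h0 i l)]
    _ = ∑ l, ∑ j, ∑ i, P i l * |M l j| := by
        rw [Finset.sum_comm]
        simp_rw [Finset.sum_comm (s := Finset.univ) (t := Finset.univ)
          (f := fun i l => P i l * |M l _|)]
        rw [Finset.sum_comm]
    _ = _ := by simp only [← Finset.sum_mul, h1, one_mul]

section member
variable {n K : ℕ} (σ : Fin n → Fin K)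

lemma cs_pos (i : Fin n) : (0 : ℝ) < clusterSize σ (σ i) := by
  unfold clusterSize
  exact_mod_cast Finset.card_pos.mpr ⟨i, by simp⟩

lemma mm_apply (i j : Fin n) :
    memberMatrix σ i j = if σ i = σ j then 1 / (clusterSize σ (σ i) : ℝ) else 0 := rfl

lemma mm_symm : (memberMatrix σ)ᵀ = memberMatrix σ := by
  ext i j
  simp only [Matrix.transpose_apply, mm_apply]
  by_cases h : σ i = σ j
  · simp [h]
  · simp [h, Ne.symm h]

lemma mm_nonneg (i j : Fin n) : 0 ≤ memberMatrix σ i j := by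
  rw [mm_apply]; split_ifs <;> positivity

lemma mm_row (i : Fin n) : ∑ j, memberMatrix σ i j = 1 := by
  simp only [mm_apply]
  rw [← Finset.sum_filter, Finset.sum_const, nsmul_eq_mul]
  have h := cs_pos σ i
  have : (Finset.univ.filter fun j => σ i = σ j).card = clusterSize σ (σ i) := by
    unfold clusterSize; congr 1; ext; simp [eq_comm]
  rw [this]; field_simp

lemma mm_congr {i l : Fin n} (h : σ i = σ l) (j : Fin n) :
    memberMatrix σ i j = memberMatrix σ l j := by
  simp only [mm_apply, h]

lemma mm_idem : memberMatrix σ * memberMatrix σ = memberMatrix σ := by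
  ext i j
  rw [Matrix.mul_apply]
  calc _ = ∑ l, memberMatrix σ i l * memberMatrix σ i j := by
        refine Finset.sum_congr rfl fun l _ => ?_
        by_cases h : σ i = σ l
        · rw [mm_congr σ h j]
        · simp [mm_apply σ i l, h]
    _ = _ := by rw [← Finset.sum_mul, mm_row, one_mul]

lemma mm_l1 (Z : Matrix (Fin n) (Fin n) ℝ) (h0 : ∀ i j, 0 ≤ Z i j) (h1 : ∀ i, ∑ j, Z i j = 1) :
    l1Norm (Z * memberMatrix σ - memberMatrix σ) ≤
      2 * ∑ i, ∑ j, (if σ i = σ j then 0 else Z i j) := by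
  unfold l1Norm
  rw [Finset.mul_sum]
  refine Finset.sum_le_sum fun i _ => ?_
  calc _ ≤ ∑ j, ∑ l, (if σ i = σ l then 0 else Z i l) *
          (memberMatrix σ l j + memberMatrix σ i j) := by
        refine Finset.sum_le_sum fun j _ => ?_
        have : (Z * memberMatrix σ - memberMatrix σ) i j
            = ∑ l, Z i l * (memberMatrix σ l j - memberMatrix σ i j) := by
          simp only [mul_sub, Finset.sum_sub_distrib, ← Finset.sum_mul, h1, one_mul,
            Matrix.sub_apply, Matrix.mul_apply]
        rw [this]
        refine (Finset.abs_sum_le_sum_abs _ _).trans (Finset.sum_le_sum fun l _ => ?_)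
        rw [abs_mul, abs_of_nonneg (h0 i l)]
        split_ifs with h
        · simp [mm_congr σ h j]
        · refine mul_le_mul_of_nonneg_left ?_ (h0 i l)
          have a := mm_nonneg σ l j
          have b := mm_nonneg σ i j
          rw [abs_le]; constructor <;> linarith
    _ = _ := by
        rw [Finset.sum_comm, Finset.mul_sum]
        refine Finset.sum_congr rfl fun l _ => ?_
        rw [← Finset.mul_sum, Finset.sum_add_distrib, mm_row, mm_row]
        ring

lemma mm_trace (Z : Matrix (Fin n) (Fin n) ℝ) (hs : ∀ i j, Z i j = Z j i)
    (h1 : ∀ i, ∑ j, Z i j = 1) :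
    (memberMatrix σ * Z).trace = (memberMatrix σ).trace -
      ∑ i, ∑ j, (if σ i = σ j then 0 else 1 / (clusterSize σ (σ i) : ℝ) * Z i j) := by
  simp only [Matrix.trace, Matrix.diag, Matrix.mul_apply]
  rw [← Finset.sum_sub_distrib]
  refine Finset.sum_congr rfl fun i _ => ?_
  rw [eq_sub_iff_add_eq, ← Finset.sum_add_distrib]
  calc _ = ∑ j, 1 / (clusterSize σ (σ i) : ℝ) * Z i j := by
        refine Finset.sum_congr rfl fun j _ => ?_
        rw [mm_apply, hs j i]
        split_ifs <;> simp
    _ = _ := by rw [← Finset.mul_sum, h1, mm_apply]; simp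

lemma S_eq (Z : Matrix (Fin n) (Fin n) ℝ) (h0 : ∀ i j, 0 ≤ Z i j) :
    (∑ k : Fin K, ∑ m ∈ Finset.univ.erase k, (1 / (clusterSize σ k : ℝ)) * blockL1 σ Z k m)
     = ∑ i, ∑ j, (if σ i = σ j then 0 else 1 / (clusterSize σ (σ i) : ℝ) * Z i j) := by
  rw [← Finset.sum_fiberwise Finset.univ σ]
  refine Finset.sum_congr rfl fun k _ => ?_
  unfold blockL1
  rw [← Finset.mul_sum, Finset.sum_comm, Finset.mul_sum]
  refine Finset.sum_congr rfl fun i hi => ?_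
  have hi : σ i = k := by simpa using hi
  subst hi
  rw [Finset.sum_fiberwise_eq_sum_filter, Finset.mul_sum, Finset.sum_filter]
  refine Finset.sum_congr rfl fun j _ => ?_
  by_cases h : σ i = σ j
  · simp [h]
  · simp [h, Ne.symm h, abs_of_nonneg (h0 i j)]

lemma cs_bound {i j : Fin n} (h : σ i ≠ σ j) :
    4 ≤ (n : ℝ) * (1 / (clusterSize σ (σ i) : ℝ) + 1 / (clusterSize σ (σ j) : ℝ)) := by
  have hi := cs_pos σ i
  have hj := cs_pos σ j
  have hn : (clusterSize σ (σ i) : ℝ) + clusterSize σ (σ j) ≤ n := by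
    have hd : Disjoint (Finset.univ.filter fun l => σ l = σ i)
        (Finset.univ.filter fun l => σ l = σ j) := by
      rw [Finset.disjoint_filter]
      intro l _ a b
      exact h (a.symm.trans b)
    have := Finset.card_le_univ ((Finset.univ.filter fun l => σ l = σ i) ∪
        (Finset.univ.filter fun l => σ l = σ j))
    rw [Finset.card_union_of_disjoint hd, Fintype.card_fin] at this
    unfold clusterSize
    exact_mod_cast this
  set a : ℝ := (clusterSize σ (σ i) : ℝ)
  set b : ℝ := (clusterSize σ (σ j) : ℝ)
  have e : 1 / a + 1 / b = (a + b) / (a * b) := by field_simp; ring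
  rw [e, mul_div_assoc', le_div_iff₀ (by positivity)]
  nlinarith [sq_nonneg (a - b), mul_le_mul_of_nonneg_right hn (add_pos hi hj).le]

lemma T_le (Z : Matrix (Fin n) (Fin n) ℝ) (hs : ∀ i j, Z i j = Z j i) (h0 : ∀ i j, 0 ≤ Z i j) :
    2 * ∑ i, ∑ j, (if σ i = σ j then 0 else Z i j) ≤
      n * ∑ i, ∑ j, (if σ i = σ j then 0 else 1 / (clusterSize σ (σ i) : ℝ) * Z i j) := by
  have e : ∑ i, ∑ j, (if σ i = σ j then 0 else 1 / (clusterSize σ (σ i) : ℝ) * Z i j)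
      = ∑ i, ∑ j, (if σ i = σ j then 0 else 1 / (clusterSize σ (σ j) : ℝ) * Z i j) := by
    rw [Finset.sum_comm]
    refine Finset.sum_congr rfl fun i _ => Finset.sum_congr rfl fun j _ => ?_
    rw [hs j i]
    simp only [eq_comm]
  have : 4 * ∑ i, ∑ j, (if σ i = σ j then 0 else Z i j) ≤
      n * (∑ i, ∑ j, (if σ i = σ j then 0 else 1 / (clusterSize σ (σ i) : ℝ) * Z i j)
      + ∑ i, ∑ j, (if σ i = σ j then 0 else 1 / (clusterSize σ (σ j) : ℝ) * Z i j)) := by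
    simp only [← Finset.sum_add_distrib, Finset.mul_sum]
    refine Finset.sum_le_sum fun i _ => Finset.sum_le_sum fun j _ => ?_
    split_ifs with h
    · simp
    · have := mul_le_mul_of_nonneg_right (cs_bound σ h) (h0 i j)
      linarith
  rw [← e] at this
  linarith

end member

/-- For any Z ∈ 𝒞 (no trace constraint),
‖Z* − Z‖₁ ≤ 4n·Σ_k Σ_{m≠k} (1/n_k)·‖Z_{G_k* G_m*}‖₁ + n·(tr(Z) − tr(Z*)). -/
theorem l1_offdiag_trace_bound {n K : ℕ} (σ : Fin n → Fin K)
    (hσ : Function.Surjective σ)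
    (Z : Matrix (Fin n) (Fin n) ℝ) (hZ : sdpFeasible Z) :
    l1Norm (memberMatrix σ - Z) ≤
      4 * (n : ℝ) *
        (∑ k : Fin K, ∑ m ∈ Finset.univ.erase k, (1 / (clusterSize σ k : ℝ)) * blockL1 σ Z k m)
      + (n : ℝ) * (Z.trace - (memberMatrix σ).trace) := by
  obtain ⟨hsym, hpsd, h1, h0⟩ := hZ
  have hs : ∀ i j, Z i j = Z j i := fun i j => (hsym.apply i j).symm
  rw [S_eq σ Z h0]
  have hT := T_le σ Z hs h0
  have htr := mm_trace σ Z hs h1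
  have hZP := mm_l1 σ Z h0 h1
  have hP0 := mm_nonneg σ
  have hPt := mm_symm σ
  have hPP := mm_idem σ
  have hPc : ∀ j, ∑ i, memberMatrix σ i j = 1 := fun j => by
    rw [← mm_row σ j]
    exact Finset.sum_congr rfl fun i _ => congrFun (congrFun hPt j) i
  generalize memberMatrix σ = P at *
  generalize (∑ i, ∑ j, (if σ i = σ j then 0 else 1 / (clusterSize σ (σ i) : ℝ) * Z i j)) = S at *
  generalize (∑ i, ∑ j, (if σ i = σ j then 0 else Z i j)) = T at *
  have hPZ : l1Norm (P * Z - P) ≤ 2 * T := by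
    rw [← l1_transpose]
    rw [Matrix.transpose_sub, Matrix.transpose_mul, hPt, hsym.eq]
    exact hZP
  have hPZP : l1Norm (P * (Z * P - P)) ≤ 2 * T := (l1_mul_le _ _ hP0 hPc).trans hZP
  have hA : ((1 - P) * Z * (1 - P)).PosSemidef := by
    have := hpsd.mul_mul_conjTranspose_same (1 - P)
    simpa [Matrix.conjTranspose_eq_transpose_of_trivial, hPt] using this
  have hAl := psd_l1_le _ hA
  have hAt : ((1 - P) * Z * (1 - P)).trace = Z.trace - P.trace + S := by
    rw [Matrix.trace_mul_comm, ← mul_assoc]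
    have : (1 - P) * (1 - P) = 1 - P := by
      simp [mul_sub, sub_mul, hPP]
    rw [this, sub_mul, one_mul, Matrix.trace_sub, htr]
    ring
  rw [hAt] at hAl
  have hdec : P - Z = -((1 - P) * Z * (1 - P)) + -(P * Z - P) + -(Z * P - P)
      + P * (Z * P - P) := by
    simp only [mul_sub, sub_mul, hPP, one_mul, mul_one, mul_assoc]
    abel
  rw [hdec]
  have a1 := l1_add (-((1 - P) * Z * (1 - P)) + -(P * Z - P) + -(Z * P - P)) (P * (Z * P - P))
  have a2 := l1_add (-((1 - P) * Z * (1 - P)) + -(P * Z - P)) (-(Z * P - P))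
  have a3 := l1_add (-((1 - P) * Z * (1 - P))) (-(P * Z - P))
  simp only [l1_neg] at a2 a3
  linarith
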